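/- arXiv:2004.00869 — 2 statements merged into one kernel-verified Lean document; each statement's English description precedes it below -/
import Mathlib

section
/- Let 𝒴 be a finite set with n = |𝒴| ≥ 2, let w : 𝒴 → ℝ be a probability vector (w_y ≥ 0, Σ_y w_y = 1), and let p : 𝒴 → [0,1]. Then there exist i ≠ j in 𝒴 such that (w_i + w_j)·h₂((w_i·p_i + w_j·p_j)/(w_i + w_j)) − w_i·h₂(p_i) − w_j·h₂(p_j) ≤ 128/n³ (with the convention that this expression equals 0 when w_i + w_j = 0). That is, merging the output symbols i and j loses at most 128/|𝒴|³ of mutual information: I(X;Y) − I(X;f_{ij}(Y)) ≤ 128/|𝒴|³. -/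
open Finset

/-- The binary entropy function (natural log, convention `0·log 0 = 0`). -/
noncomputable def h2 (t : ℝ) : ℝ := Real.negMulLog t + Real.negMulLog (1 - t)

/-- The tangent-line bound for `x ↦ x log x`. -/
lemma neg_negMulLog_le {x q : ℝ} (hx : 0 ≤ x) (hq : 0 < q) :
    -Real.negMulLog x ≤ x * Real.log q + x * (x / q - 1) := by
  rcases hx.eq_or_lt with rfl | hx
  · simp
  have h := Real.log_le_sub_one_of_pos (div_pos hx hq)
  rw [Real.log_div hx.ne' hq.ne'] at h
  have := mul_le_mul_of_nonneg_left h hx.le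
  simp only [Real.negMulLog]
  linarith

/-- The Jensen gap of `negMulLog` at two points is bounded by a squared difference of
square roots. -/
lemma negMulLog_jensen_gap_le {a b W x y : ℝ} (ha : 0 ≤ a) (hb : 0 ≤ b) (haW : a ≤ W)
    (hbW : b ≤ W) (hx : 0 ≤ x) (hy : 0 ≤ y) :
    (a + b) * Real.negMulLog ((a * x + b * y) / (a + b))
        - a * Real.negMulLog x - b * Real.negMulLog y
      ≤ 2 * W * (√x - √y) ^ 2 := by
  have hax := mul_nonneg ha hx
  have hby := mul_nonneg hb hy
  have hW : 0 ≤ W := ha.trans haW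
  rcases (add_nonneg hax hby).eq_or_lt with hM | hM
  · have hax0 : a * x = 0 := by linarith
    have hby0 : b * y = 0 := by linarith
    have h1 : a * Real.negMulLog x = 0 := by
      rw [Real.negMulLog, ← mul_assoc, mul_neg, hax0]; simp
    have h2 : b * Real.negMulLog y = 0 := by
      rw [Real.negMulLog, ← mul_assoc, mul_neg, hby0]; simp
    rw [← hM, h1, h2]
    simp only [zero_div, Real.negMulLog_zero, mul_zero, sub_zero]
    positivity
  have hS : 0 < a + b := by
    by_contra h
    have ha0 : a = 0 := by linarith
    have hb0 : b = 0 := by linarith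
    simp [ha0, hb0] at hM
  have hq := div_pos hM hS
  have h1 := mul_le_mul_of_nonneg_left (neg_negMulLog_le hx hq) ha
  have h2 := mul_le_mul_of_nonneg_left (neg_negMulLog_le hy hq) hb
  have h3 : (a + b) * Real.negMulLog ((a * x + b * y) / (a + b))
      = -((a * x + b * y) * Real.log ((a * x + b * y) / (a + b))) := by
    rw [Real.negMulLog]; field_simp
  have h4 : a * (x * (x / ((a * x + b * y) / (a + b)) - 1))
      + b * (y * (y / ((a * x + b * y) / (a + b)) - 1))
      = a * b * (x - y) ^ 2 / (a * x + b * y) := by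
    field_simp; ring
  have h5 : a * b * (x - y) ^ 2 / (a * x + b * y) ≤ 2 * W * (√x - √y) ^ 2 := by
    rw [div_le_iff₀ hM]
    have hsx := Real.sq_sqrt hx
    have hsy := Real.sq_sqrt hy
    have e : (x - y) ^ 2 = (√x - √y) ^ 2 * (√x + √y) ^ 2 := by
      nth_rewrite 1 [← hsx, ← hsy]; ring
    have k1 : (√x + √y) ^ 2 ≤ 2 * (x + y) := by nlinarith [sq_nonneg (√x - √y)]
    have k2 : a * b * (x + y) ≤ W * (a * x + b * y) := by
      nlinarith [mul_le_mul_of_nonneg_left hbW hax, mul_le_mul_of_nonneg_left haW hby]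
    have k3 : a * b * (√x + √y) ^ 2 ≤ 2 * (W * (a * x + b * y)) := by
      nlinarith [mul_le_mul_of_nonneg_left k1 (mul_nonneg ha hb)]
    rw [e]
    nlinarith [mul_le_mul_of_nonneg_left k3 (sq_nonneg (√x - √y))]
  linarith

/-- A strictly increasing coordinate on `[0, 1]` with values in `[-1, 1]`, whose squared
increments dominate squared Hellinger distances of Bernoulli laws. -/
noncomputable def hellingerCoord (t : ℝ) : ℝ := √t - √(1 - t)

lemma hellinger_le_hellingerCoord_sq (x y : ℝ) :
    (√x - √y) ^ 2 + (√(1 - x) - √(1 - y)) ^ 2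
      ≤ (hellingerCoord x - hellingerCoord y) ^ 2 := by
  have h : (√x - √y) * (√(1 - x) - √(1 - y)) ≤ 0 := by
    rcases le_total x y with h | h
    · exact mul_nonpos_of_nonpos_of_nonneg (sub_nonpos.2 (Real.sqrt_le_sqrt h))
        (sub_nonneg.2 (Real.sqrt_le_sqrt (by linarith)))
    · exact mul_nonpos_of_nonneg_of_nonpos (sub_nonneg.2 (Real.sqrt_le_sqrt h))
        (sub_nonpos.2 (Real.sqrt_le_sqrt (by linarith)))
  unfold hellingerCoord
  nlinarith

lemma hellingerCoord_mem_Icc {t : ℝ} (h0 : 0 ≤ t) (h1 : t ≤ 1) :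
    hellingerCoord t ∈ Set.Icc (-1) 1 := by
  have a := Real.sqrt_nonneg t
  have b := Real.sqrt_nonneg (1 - t)
  have c : √t ≤ 1 := Real.sqrt_le_one.2 h1
  have d : √(1 - t) ≤ 1 := Real.sqrt_le_one.2 (by linarith)
  constructor <;> unfold hellingerCoord <;> linarith

lemma merge_cost_le {a b W x y : ℝ} (ha : 0 ≤ a) (hb : 0 ≤ b) (haW : a ≤ W)
    (hbW : b ≤ W) (hx : 0 ≤ x ∧ x ≤ 1) (hy : 0 ≤ y ∧ y ≤ 1) :
    (a + b) * h2 ((a * x + b * y) / (a + b)) - a * h2 x - b * h2 y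
      ≤ 2 * W * (hellingerCoord x - hellingerCoord y) ^ 2 := by
  have hW : 0 ≤ W := ha.trans haW
  rcases (add_nonneg ha hb).eq_or_lt with hS | hS
  · have ha0 : a = 0 := by linarith
    have hb0 : b = 0 := by linarith
    simp only [ha0, hb0, add_zero, zero_mul, sub_zero]
    positivity
  have e : 1 - (a * x + b * y) / (a + b) = (a * (1 - x) + b * (1 - y)) / (a + b) := by
    field_simp; ring
  have h1 := negMulLog_jensen_gap_le ha hb haW hbW hx.1 hy.1
  have hcompl := negMulLog_jensen_gap_le ha hb haW hbW (sub_nonneg.2 hx.2) (sub_nonneg.2 hy.2)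
  have h3 := mul_le_mul_of_nonneg_left (hellinger_le_hellingerCoord_sq x y)
    (mul_nonneg zero_le_two hW)
  simp only [h2, e]
  linarith

lemma h2_eq_binEntropy (t : ℝ) : h2 t = Real.binEntropy t :=
  (Real.binEntropy_eq_negMulLog_add_negMulLog_one_sub t).symm

lemma merge_cost_le_add {a b x y : ℝ} (ha : 0 ≤ a) (hb : 0 ≤ b)
    (hx : 0 ≤ x ∧ x ≤ 1) (hy : 0 ≤ y ∧ y ≤ 1) :
    (a + b) * h2 ((a * x + b * y) / (a + b)) - a * h2 x - b * h2 y ≤ a + b := by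
  simp only [h2_eq_binEntropy]
  have h1 := mul_nonneg ha (Real.binEntropy_nonneg hx.1 hx.2)
  have hcompl := mul_nonneg hb (Real.binEntropy_nonneg hy.1 hy.2)
  have h3 : Real.binEntropy ((a * x + b * y) / (a + b)) ≤ 1 :=
    Real.binEntropy_le_log_two.trans (by linarith [Real.log_two_lt_d9])
  nlinarith [mul_le_mul_of_nonneg_left h3 (add_nonneg ha hb)]

/-- Pigeonhole: more than `K` points in `[0, K]` include two at distance at most `1`. -/
lemma exists_ne_abs_sub_le_one {ι : Type*} {s : Finset ι} {K : ℕ} (hK : 0 < K)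
    (hs : K < #s) (f : ι → ℝ) (hf : ∀ i ∈ s, f i ∈ Set.Icc (0 : ℝ) K) :
    ∃ i ∈ s, ∃ j ∈ s, i ≠ j ∧ |f i - f j| ≤ 1 := by
  have key : ∀ i ∈ s, ((min ⌊f i⌋₊ (K - 1) : ℕ) : ℝ) ≤ f i ∧
      f i ≤ ((min ⌊f i⌋₊ (K - 1) : ℕ) : ℝ) + 1 := by
    intro i hi
    obtain ⟨h0, h1⟩ := hf i hi
    refine ⟨(Nat.cast_le.2 (min_le_left _ _)).trans (Nat.floor_le h0), ?_⟩
    rcases le_total ⌊f i⌋₊ (K - 1) with h | h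
    · rw [min_eq_left h]; exact (Nat.lt_floor_add_one _).le
    · rw [min_eq_right h, Nat.cast_pred hK]; linarith
  obtain ⟨i, hi, j, hj, hij, h⟩ := exists_ne_map_eq_of_card_lt_of_maps_to
    (s := s) (t := range K) (f := fun i => min ⌊f i⌋₊ (K - 1)) (by simpa using hs)
    (fun i _ => by simp only [coe_range, Set.mem_Iio]; omega)
  refine ⟨i, hi, j, hj, hij, ?_⟩
  have k1 := key i hi
  have k2 := key j hj
  rw [h] at k1
  rw [abs_le]
  constructor <;> linarith [k1.1, k1.2, k2.1, k2.2]

/-- More than half of the atoms of a probability vector have at most twice the average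
weight. -/
lemma card_lt_two_mul_card_light {Y : Type*} [Fintype Y] (hn : 0 < Fintype.card Y)
    (w : Y → ℝ) (hw0 : ∀ y, 0 ≤ w y) (hw1 : ∑ y, w y = 1) :
    Fintype.card Y < 2 * #{y | w y ≤ 2 / (Fintype.card Y : ℝ)} := by
  set n := Fintype.card Y
  have hnR : (0 : ℝ) < n := by exact_mod_cast hn
  have hsplit := card_filter_add_card_filter_not (s := (univ : Finset Y))
    (fun y => w y ≤ 2 / (n : ℝ))
  rw [card_univ] at hsplit
  set B : Finset Y := {y | ¬ w y ≤ 2 / (n : ℝ)}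
  suffices h : 2 * #B < n by omega
  rcases B.eq_empty_or_nonempty with h | h
  · simpa [h] using hn
  have h1 : ∑ y ∈ B, 2 / (n : ℝ) < ∑ y ∈ B, w y :=
    sum_lt_sum_of_nonempty h fun y hy => not_le.1 (mem_filter.1 hy).2
  have hcompl : ∑ y ∈ B, w y ≤ 1 :=
    hw1 ▸ sum_le_sum_of_subset_of_nonneg (subset_univ B) fun y _ _ => hw0 y
  rw [sum_const, nsmul_eq_mul] at h1
  have h3 := h1.trans_le hcompl
  rw [← mul_div_assoc, div_lt_one hnR] at h3
  have h4 : #B * 2 < n := by exact_mod_cast h3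
  omega

/-- One merge step is cheap: with `Y` a finite set of size `n ≥ 2`, law `w`, posteriors
`p`, there exist `i ≠ j` whose merging cost
`(w_i+w_j)·h₂((w_i·p_i+w_j·p_j)/(w_i+w_j)) − w_i·h₂(p_i) − w_j·h₂(p_j)`
(i.e. `I(X;Y) − I(X;f_{ij}(Y))`) is at most `128/n³`.  (When `w_i + w_j = 0` the
expression equals `0`, consistent with the convention, since division by zero is `0`
and `w_i = w_j = 0`.) -/
theorem one_step_merge {Y : Type*} [Fintype Y] (hn : 2 ≤ Fintype.card Y)
    (w p : Y → ℝ) (hw0 : ∀ y, 0 ≤ w y) (hw1 : ∑ y, w y = 1)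
    (hp : ∀ y, 0 ≤ p y ∧ p y ≤ 1) :
    ∃ i j : Y, i ≠ j ∧
      (w i + w j) * h2 ((w i * p i + w j * p j) / (w i + w j))
          - w i * h2 (p i) - w j * h2 (p j)
        ≤ 128 / (Fintype.card Y : ℝ) ^ 3 := by
  classical
  set n := Fintype.card Y with hn_def
  have hnR : (0 : ℝ) < n := by exact_mod_cast (by omega : 0 < n)
  by_cases hsmall : n ≤ 3
  · obtain ⟨i, j, hij⟩ := Fintype.exists_pair_of_one_lt_card (by omega : 1 < Fintype.card Y)
    refine ⟨i, j, hij, (merge_cost_le_add (hw0 i) (hw0 j) (hp i) (hp j)).trans ?_⟩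
    have hle : w i + w j ≤ 1 := by
      rw [← hw1, ← sum_pair hij]
      exact sum_le_sum_of_subset_of_nonneg (subset_univ _) fun y _ _ => hw0 y
    have hn3 : (n : ℝ) ^ 3 ≤ 3 ^ 3 := by
      gcongr; exact_mod_cast hsmall
    refine hle.trans ?_
    rw [le_div_iff₀ (by positivity)]
    linarith
  have hlight := card_lt_two_mul_card_light (by omega) w hw0 hw1
  rw [← hn_def] at hlight
  set s : Finset Y := {y | w y ≤ 2 / (n : ℝ)}
  obtain ⟨K, hK⟩ : ∃ K, #s = K + 1 := ⟨#s - 1, by omega⟩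
  have hK2 : 2 ≤ K := by omega
  have hKR : (2 : ℝ) ≤ K := by exact_mod_cast hK2
  have hnK : (n : ℝ) ≤ 2 * K + 1 := by exact_mod_cast (by omega : n ≤ 2 * K + 1)
  obtain ⟨i, hi, j, hj, hij, hd⟩ := exists_ne_abs_sub_le_one (s := s) (K := K) (by omega)
    (by omega) (fun y => K / 2 * (hellingerCoord (p y) + 1)) (by
      intro y _
      obtain ⟨h0, h1⟩ := hellingerCoord_mem_Icc (hp y).1 (hp y).2
      constructor <;> nlinarith)
  refine ⟨i, j, hij, (merge_cost_le (hw0 i) (hw0 j) (mem_filter.1 hi).2 (mem_filter.1 hj).2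
    (hp i) (hp j)).trans ?_⟩
  have hd2 := (sq_le_one_iff_abs_le_one _).2 hd
  have hg : (K : ℝ) ^ 2 * (hellingerCoord (p i) - hellingerCoord (p j)) ^ 2 ≤ 4 := by
    nlinarith
  have hn2 : (n : ℝ) ^ 2 ≤ 8 * K ^ 2 := by nlinarith
  have hfin : (n : ℝ) ^ 2 * (hellingerCoord (p i) - hellingerCoord (p j)) ^ 2 ≤ 32 := by
    nlinarith [mul_le_mul_of_nonneg_right hn2
      (sq_nonneg (hellingerCoord (p i) - hellingerCoord (p j)))]
  rw [le_div_iff₀ (by positivity)]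
  calc 2 * (2 / (n : ℝ)) * (hellingerCoord (p i) - hellingerCoord (p j)) ^ 2 * n ^ 3
      = 4 * ((n : ℝ) ^ 2 * (hellingerCoord (p i) - hellingerCoord (p j)) ^ 2) := by
        field_simp; ring
    _ ≤ 128 := by linarith
end

section
/- For all 0 ≤ p₀ ≤ p₁ ≤ 1 with 0 < p₀ + p₁ < 2, and all α ∈ [0,1]: h₂(α·p₀ + (1−α)·p₁) − α·h₂(p₀) − (1−α)·h₂(p₁) ≤ (p₁ − p₀)²/((p₀ + p₁)·(2 − p₀ − p₁)). -/
/-- The Gibbs inequality for a single term: the tangent line bound for `negMulLog`. -/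
theorem negMulLog_le_cross {x m : ℝ} (hx : 0 ≤ x) (hm : 0 < m) :
    Real.negMulLog x ≤ -x * Real.log m + (m - x) := by
  rcases hx.eq_or_lt with rfl | hx
  · simpa using hm.le
  · have h := mul_le_mul_of_nonneg_left (Real.log_le_sub_one_of_pos (div_pos hm hx)) hx.le
    rw [Real.log_div hm.ne' hx.ne', mul_sub x (m / x), mul_div_cancel₀ m hx.ne'] at h
    simp only [Real.negMulLog]
    linarith

/-- Single-term form of the bound of the Kullback–Leibler divergence by the χ² divergence. -/
theorem cross_sub_le_negMulLog {x m : ℝ} (hx : 0 ≤ x) (hm : 0 < m) :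
    -x * Real.log m - x * (x / m - 1) ≤ Real.negMulLog x := by
  rcases hx.eq_or_lt with rfl | hx
  · simp
  · have h := mul_le_mul_of_nonneg_left (Real.log_le_sub_one_of_pos (div_pos hx hm)) hx.le
    rw [Real.log_div hx.ne' hm.ne'] at h
    simp only [Real.negMulLog]
    linarith

/-- The binary entropy is at most the cross entropy. -/
theorem h2_le_cross {q m : ℝ} (hq0 : 0 ≤ q) (hq1 : q ≤ 1) (hm0 : 0 < m) (hm1 : m < 1) :
    h2 q ≤ -q * Real.log m - (1 - q) * Real.log (1 - m) := by
  have h := negMulLog_le_cross hq0 hm0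
  have hcompl := negMulLog_le_cross (sub_nonneg.2 hq1) (sub_pos.2 hm1)
  simp only [h2]
  linarith

/-- The binary divergence, cross entropy minus entropy, is at most the χ² divergence. -/
theorem cross_sub_chiSq_le_h2 {p m : ℝ} (hp0 : 0 ≤ p) (hp1 : p ≤ 1) (hm0 : 0 < m) (hm1 : m < 1) :
    -p * Real.log m - (1 - p) * Real.log (1 - m) - (p - m) ^ 2 / (m * (1 - m)) ≤ h2 p := by
  have h := cross_sub_le_negMulLog hp0 hm0
  have hcompl := cross_sub_le_negMulLog (sub_nonneg.2 hp1) (sub_pos.2 hm1)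
  have hchi : p * (p / m - 1) + (1 - p) * ((1 - p) / (1 - m) - 1)
      = (p - m) ^ 2 / (m * (1 - m)) := by
    have := hm0.ne'
    have := (sub_pos.2 hm1).ne'
    field_simp
    ring
  simp only [h2]
  linarith

/-- Quadratic (χ²-type) bound on the concavity gap of the binary entropy function. -/
theorem h2_gap_le_chiSq (p₀ p₁ α : ℝ)
    (h0 : 0 ≤ p₀) (h01 : p₀ ≤ p₁) (h1 : p₁ ≤ 1)
    (hsum0 : 0 < p₀ + p₁) (hsum2 : p₀ + p₁ < 2)
    (hα0 : 0 ≤ α) (hα1 : α ≤ 1) :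
    h2 (α * p₀ + (1 - α) * p₁) - α * h2 p₀ - (1 - α) * h2 p₁
      ≤ (p₁ - p₀) ^ 2 / ((p₀ + p₁) * (2 - p₀ - p₁)) := by
  have hβ : 0 ≤ 1 - α := sub_nonneg.2 hα1
  have hp₁ : 0 ≤ p₁ := h0.trans h01
  have hp₀ : p₀ ≤ 1 := h01.trans h1
  obtain ⟨m, hm⟩ : ∃ m, m = (p₀ + p₁) / 2 := ⟨_, rfl⟩
  have hm0 : 0 < m := by linarith
  have hm1 : m < 1 := by linarith
  have hden : (p₀ + p₁) * (2 - p₀ - p₁) = 4 * (m * (1 - m)) := by rw [hm]; ring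
  have hchi₀ : (p₀ - m) ^ 2 / (m * (1 - m))
      = (p₁ - p₀) ^ 2 / ((p₀ + p₁) * (2 - p₀ - p₁)) := by
    rw [hden, ← mul_div_mul_left _ (m * (1 - m)) (four_ne_zero' ℝ)]
    congr 1
    rw [hm]; ring
  have hchi₁ : (p₁ - m) ^ 2 / (m * (1 - m))
      = (p₁ - p₀) ^ 2 / ((p₀ + p₁) * (2 - p₀ - p₁)) := by
    rw [← hchi₀]
    congr 1
    rw [hm]; ring
  have hq0 : 0 ≤ α * p₀ + (1 - α) * p₁ := by positivity
  have hq1 : α * p₀ + (1 - α) * p₁ ≤ 1 := by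
    linarith [mul_le_mul_of_nonneg_left hp₀ hα0, mul_le_mul_of_nonneg_left h1 hβ]
  have hq := h2_le_cross hq0 hq1 hm0 hm1
  have hgap₀ := mul_le_mul_of_nonneg_left (cross_sub_chiSq_le_h2 h0 hp₀ hm0 hm1) hα0
  have hgap₁ := mul_le_mul_of_nonneg_left (cross_sub_chiSq_le_h2 hp₁ h1 hm0 hm1) hβ
  rw [hchi₀] at hgap₀
  rw [hchi₁] at hgap₁
  linarith
end
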